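/- arXiv:2209.09473 — 2 statements merged into one kernel-verified Lean document; each statement's English description precedes it below -/
import Mathlib

section
/- (Theorem 1, Property 2.) Let [M, s_0 ⊨ ⟨⟨Agt⟩⟩Φ]_{Opt}^{Res} be a resource cost-optimal strategy synthesis problem with latest deadline k, and let its WCNF encoding be F^{Res}_{Opt} = H' ∧ Soft, where H' are hard clauses over a variable set containing variables nu_r for r ∈ Res and Soft consists of the soft clauses (nu_r, $(r)) for r ∈ Res, such that: (i) every assignment α satisfying H' characterises a joint winning strategy σ^α, and every joint winning strategy is characterised by some assignment satisfying H'; and (ii) for every assignment α satisfying H' and every r ∈ Res, α(nu_r) = 1 if and only if resource r is unallocated in all states π(s_0, σ^α)(t) for 0 ≤ t ≤ k. If max-sat(F^{Res}_{Opt}) = α, then σ^α is a resource cost-optimal winning strategy, i.e. σ^α is winning and every winning strategy σ' satisfies c_Res(π(s_0, σ')) ≥ c_Res(π(s_0, σ^α)). -/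
/-- Actions available to an agent in an MRA: request a resource, release a
resource, release all held resources, or idle. -/
inductive MRAAct (R : Type*) where
  | req : R → MRAAct R
  | rel : R → MRAAct R
  | relAll : MRAAct R
  | idle : MRAAct R

/-- A state of an MRA maps each resource to the agent holding it (`some a`)
or to `none`, representing the dummy agent `a₀` (the resource is unallocated).
The action availability protocol: `req r` is available iff `r` is unallocated,
`rel r` iff the agent holds `r`, `relAll` iff the agent holds some resource,
and `idle` is always available. -/
def MRAAvail {A R : Type*} (s : R → Option A) (a : A) : MRAAct R → Prop
  | .req r => s r = none
  | .rel r => s r = some a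
  | .relAll => ∃ r, s r = some a
  | .idle => True

/-- An action profile `ap` is executable in `s` if every agent's chosen
action is available to it. -/
def MRAExec {A R : Type*} (s : R → Option A) (ap : A → MRAAct R) : Prop :=
  ∀ a, MRAAvail s a (ap a)

/-- `a` is the unique agent requesting resource `r` under profile `ap`. -/
def UniqueRequester {A R : Type*} (ap : A → MRAAct R) (r : R) (a : A) : Prop :=
  ap a = MRAAct.req r ∧ ∀ a', ap a' = MRAAct.req r → a' = a

/-- The evolution relation `δ`: `(s, ap, s') ∈ δ` iff `ap` is executable in
`s` and, for each resource `r`: an unallocated `r` becomes allocated by `a`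
iff `a` is the unique requester of `r`, otherwise stays unallocated; an `r`
allocated by `a` becomes unallocated iff `a` releases it (individually or via
release-all), otherwise stays with `a`. -/
def MRAEvolve {A R : Type*} (s : R → Option A) (ap : A → MRAAct R)
    (s' : R → Option A) : Prop :=
  MRAExec s ap ∧ ∀ r : R,
    (s r = none →
      (∀ a, UniqueRequester ap r a → s' r = some a) ∧
      ((¬ ∃ a, UniqueRequester ap r a) → s' r = none)) ∧
    (∀ a : A, s r = some a →
      ((ap a = MRAAct.rel r ∨ ap a = MRAAct.relAll) → s' r = none) ∧
      (¬ (ap a = MRAAct.rel r ∨ ap a = MRAAct.relAll) → s' r = some a))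

/-- A joint (uniform) strategy: for each agent, a function from states to
actions. -/
def MRAStrategy (A R : Type*) := A → (R → Option A) → MRAAct R

/-- `π` is the outcome path of the joint strategy `σ` from the initial state
`s₀` (all resources unallocated): at every time step, every agent's chosen
action is available and the system evolves according to `δ`. -/
def IsOutcome {A R : Type*} (σ : MRAStrategy A R) (π : ℕ → R → Option A) : Prop :=
  (∀ r, π 0 r = none) ∧
  ∀ t, MRAExec (π t) (fun a => σ a (π t)) ∧
       MRAEvolve (π t) (fun a => σ a (π t)) (π (t + 1))

/-- Agent `a` achieves the goal `(Rc, p, d)` on path `π`: for some `t ≤ d − p`,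
for every resource type `τ ∈ Rc` there is a resource `r` of type `τ` held by
`a` during all of `[t, t + p]`. -/
def Achieves {A R T : Type*} (typeOf : R → T) (π : ℕ → R → Option A) (a : A)
    (Rc : Finset T) (p d : ℕ) : Prop :=
  ∃ t, t ≤ d - p ∧ ∀ τ ∈ Rc, ∃ r, typeOf r = τ ∧
    ∀ t', t ≤ t' → t' ≤ t + p → π t' r = some a

open Classical in
/-- The resource cost of a path up to the latest deadline `k`: the sum of the
prices of all resources that are ever allocated along the path up to time `k`. -/
noncomputable def cRes {A R T : Type*} [Fintype R] (typeOf : R → T)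
    (price : T → ℕ) (k : ℕ) (π : ℕ → R → Option A) : ℕ :=
  ∑ r : R, if ∀ t ≤ k, π t r = none then 0 else price (typeOf r)

open Classical in
/-- The agent cost of a path up to the latest deadline `k`: the sum of the
agent price `priceA` over all agents that ever allocate some resource along
the path up to time `k`. -/
noncomputable def cAgt {A R : Type*} [Fintype A] (priceA : ℕ) (k : ℕ)
    (π : ℕ → R → Option A) : ℕ :=
  ∑ a : A, if ∀ t ≤ k, ∀ r, π t r ≠ some a then 0 else priceA

/-- The MRA cost of a path: resource cost plus agent cost. -/
noncomputable def cMRA {A R T : Type*} [Fintype A] [Fintype R] (typeOf : R → T)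
    (price : T → ℕ) (priceA : ℕ) (k : ℕ) (π : ℕ → R → Option A) : ℕ :=
  cRes typeOf price k π + cAgt priceA k π

/-- A literal is a variable together with a polarity; a clause is a finite
set (disjunction) of literals. An assignment `α` satisfies a clause if it
makes at least one of its literals true. -/
def ClauseSat {V : Type*} (α : V → Bool) (c : Finset (V × Bool)) : Prop :=
  ∃ l ∈ c, α l.1 = l.2

/-- The weight of the soft clauses satisfied by `α` and the resource cost of `π` add up to the
total price, provided `α` marks exactly the resources that `π` leaves unallocated. -/
theorem softWeight_add_cRes {A R T V : Type*} [Fintype R] (typeOf : R → T) (price : T → ℕ)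
    (k : ℕ) (π : ℕ → R → Option A) (α : V ⊕ R → Bool)
    (h : ∀ r : R, α (Sum.inr r) = true ↔ ∀ t ≤ k, π t r = none) :
    (∑ r : R, if α (Sum.inr r) = true then price (typeOf r) else 0) + cRes typeOf price k π =
      ∑ r : R, price (typeOf r) := by
  rw [cRes, ← Finset.sum_add_distrib]
  refine Finset.sum_congr rfl fun r _ => ?_
  by_cases hr : ∀ t ≤ k, π t r = none
  · rw [if_pos ((h r).2 hr), if_pos hr, add_zero]
  · rw [if_neg (mt (h r).1 hr), if_neg hr, zero_add]

/-- Theorem 1, Property 2. The WCNF encoding `F = H' ∧ Soft` of the resource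
cost-optimal strategy synthesis problem, over a variable set `V ⊕ R`
containing the variables `nu_r := Sum.inr r` for `r ∈ R`, with soft clauses
`(nu_r, $(r))`. Hypotheses: (i) every assignment `α` satisfying the hard
clauses `H'` characterises a joint winning strategy `σs α` (with outcome path
`πs α`), and every joint winning strategy is characterised by some assignment
satisfying `H'`; (ii) for every `α` satisfying `H'` and every resource `r`,
`α(nu_r) = 1` iff `r` is unallocated in all states of `πs α` up to the latest
deadline `k = Finset.univ.sup gD`. If `max-sat(F) = α*`, i.e. `α*` satisfies
`H'` and maximises the sum of weights of satisfied soft clauses among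
assignments satisfying `H'`, then `σs α*` is a resource cost-optimal winning
strategy: it is winning and every winning strategy `σ'` satisfies
`c_Res(π(s₀,σ')) ≥ c_Res(π(s₀,σs α*))`. -/
theorem maxSat_gives_resource_costOptimal_strategy {A R T ι V : Type*}
    [Fintype A] [Fintype R] [Fintype ι]
    (typeOf : R → T) (price : T → ℕ)
    (gA : ι → A) (gR : ι → Finset T) (gP gD : ι → ℕ)
    (H' : Set (Finset ((V ⊕ R) × Bool)))
    (σs : (V ⊕ R → Bool) → MRAStrategy A R)
    (πs : (V ⊕ R → Bool) → ℕ → R → Option A)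
    (hchar : ∀ α : V ⊕ R → Bool, (∀ c ∈ H', ClauseSat α c) →
      IsOutcome (σs α) (πs α) ∧
      ∀ i, Achieves typeOf (πs α) (gA i) (gR i) (gP i) (gD i))
    (hsurj : ∀ (σ : MRAStrategy A R) (π : ℕ → R → Option A),
      IsOutcome σ π → (∀ i, Achieves typeOf π (gA i) (gR i) (gP i) (gD i)) →
      ∃ α : V ⊕ R → Bool, (∀ c ∈ H', ClauseSat α c) ∧ σs α = σ ∧ πs α = π)
    (hnu : ∀ α : V ⊕ R → Bool, (∀ c ∈ H', ClauseSat α c) →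
      ∀ r : R, (α (Sum.inr r) = true ↔
        ∀ t ≤ Finset.univ.sup gD, πs α t r = none))
    (αstar : V ⊕ R → Bool) (hαstar : ∀ c ∈ H', ClauseSat αstar c)
    (hmax : ∀ β : V ⊕ R → Bool, (∀ c ∈ H', ClauseSat β c) →
      (∑ r : R, if β (Sum.inr r) = true then price (typeOf r) else 0) ≤
      (∑ r : R, if αstar (Sum.inr r) = true then price (typeOf r) else 0)) :
    (IsOutcome (σs αstar) (πs αstar) ∧
      ∀ i, Achieves typeOf (πs αstar) (gA i) (gR i) (gP i) (gD i)) ∧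
    ∀ (σ' : MRAStrategy A R) (π' : ℕ → R → Option A),
      IsOutcome σ' π' → (∀ i, Achieves typeOf π' (gA i) (gR i) (gP i) (gD i)) →
      cRes typeOf price (Finset.univ.sup gD) (πs αstar) ≤
        cRes typeOf price (Finset.univ.sup gD) π' := by
  refine ⟨hchar αstar hαstar, fun σ' π' hout hgoal => ?_⟩
  obtain ⟨β, hβ, -, rfl⟩ := hsurj σ' π' hout hgoal
  have hstar := softWeight_add_cRes typeOf price _ _ αstar (hnu αstar hαstar)
  have hother := softWeight_add_cRes typeOf price _ _ β (hnu β hβ)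
  have hle := hmax β hβ
  omega
end

section
/- (Theorem 2, Property 2.) Let [M, s_0 ⊨ ⟨⟨Agt⟩⟩Φ*]_{Opt}^{M} be an MRA cost-optimal strategy synthesis problem with latest deadline k and agent price $_A, and let its WCNF encoding be F^{M}_{Opt} = H' ∧ Soft, where H' are hard clauses over a variable set containing variables nu_r for r ∈ Res and nu_a for a ∈ Agt, and Soft consists of the soft clauses (nu_r, $(r)) for r ∈ Res and (nu_a, $_A) for a ∈ Agt, such that: (i) every assignment α satisfying H' characterises a joint winning strategy σ^α, and every joint winning strategy is characterised by some assignment satisfying H'; (ii) for every assignment α satisfying H' and every r ∈ Res, α(nu_r) = 1 iff r is unallocated in all states π(s_0, σ^α)(t) for 0 ≤ t ≤ k; and (iii) for every such α and every a ∈ Agt, α(nu_a) = 1 iff a allocates no resource in any state π(s_0, σ^α)(t) for 0 ≤ t ≤ k. If max-sat(F^{M}_{Opt}) = α, then σ^α is an MRA cost-optimal winning strategy, i.e. σ^α is winning and every winning strategy σ' satisfies c_M(π(s_0, σ')) ≥ c_M(π(s_0, σ^α)). -/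
/-- The total weight splits into the part where `P` holds and the part where it fails. -/
theorem sum_ite_add_sum_ite_compl {X : Type*} [Fintype X] (P Q : X → Prop)
    [DecidablePred P] [DecidablePred Q] (h : ∀ x, P x ↔ Q x) (w : X → ℕ) :
    (∑ x, if P x then w x else 0) + (∑ x, if Q x then 0 else w x) = ∑ x, w x := by
  rw [← Finset.sum_add_distrib]
  refine Finset.sum_congr rfl fun x _ => ?_
  by_cases hx : Q x <;> simp [h x, hx]

/-- Theorem 2, Property 2. The WCNF encoding `F = H' ∧ Soft` of the MRA
cost-optimal strategy synthesis problem for goals `Φ*` not assigned to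
particular agents, over a variable set `V ⊕ (R ⊕ A)` containing the variables
`nu_r := Sum.inr (Sum.inl r)` for `r ∈ R` and `nu_a := Sum.inr (Sum.inr a)`
for `a ∈ A`, with soft clauses `(nu_r, $(r))` and `(nu_a, $_A)`. Hypotheses:
(i) every assignment `α` satisfying the hard clauses `H'` characterises a
joint winning strategy `σs α` (with outcome path `πs α`), and every joint
winning strategy is characterised by some assignment satisfying `H'`;
(ii) for every such `α` and every resource `r`, `α(nu_r) = 1` iff `r` is
unallocated in all states of `πs α` up to the latest deadline
`k = Finset.univ.sup gD`; (iii) for every such `α` and every agent `a`,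
`α(nu_a) = 1` iff `a` allocates no resource in any state of `πs α` up to `k`.
If `max-sat(F) = α*`, i.e. `α*` satisfies `H'` and maximises the sum of
weights of satisfied soft clauses among assignments satisfying `H'`, then
`σs α*` is an MRA cost-optimal winning strategy: it is winning and every
winning strategy `σ'` satisfies `c_M(π(s₀,σ')) ≥ c_M(π(s₀,σs α*))`. -/
theorem maxSat_gives_MRA_costOptimal_strategy {A R T ι V : Type*}
    [Fintype A] [Fintype R] [Fintype ι]
    (typeOf : R → T) (price : T → ℕ) (priceA : ℕ)
    (gR : ι → Finset T) (gP gD : ι → ℕ)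
    (H' : Set (Finset ((V ⊕ (R ⊕ A)) × Bool)))
    (σs : (V ⊕ (R ⊕ A) → Bool) → MRAStrategy A R)
    (πs : (V ⊕ (R ⊕ A) → Bool) → ℕ → R → Option A)
    (hchar : ∀ α : V ⊕ (R ⊕ A) → Bool, (∀ c ∈ H', ClauseSat α c) →
      IsOutcome (σs α) (πs α) ∧
      ∀ i, ∃ a : A, Achieves typeOf (πs α) a (gR i) (gP i) (gD i))
    (hsurj : ∀ (σ : MRAStrategy A R) (π : ℕ → R → Option A),
      IsOutcome σ π → (∀ i, ∃ a : A, Achieves typeOf π a (gR i) (gP i) (gD i)) →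
      ∃ α : V ⊕ (R ⊕ A) → Bool, (∀ c ∈ H', ClauseSat α c) ∧ σs α = σ ∧ πs α = π)
    (hnuR : ∀ α : V ⊕ (R ⊕ A) → Bool, (∀ c ∈ H', ClauseSat α c) →
      ∀ r : R, (α (Sum.inr (Sum.inl r)) = true ↔
        ∀ t ≤ Finset.univ.sup gD, πs α t r = none))
    (hnuA : ∀ α : V ⊕ (R ⊕ A) → Bool, (∀ c ∈ H', ClauseSat α c) →
      ∀ a : A, (α (Sum.inr (Sum.inr a)) = true ↔
        ∀ t ≤ Finset.univ.sup gD, ∀ r : R, πs α t r ≠ some a))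
    (αstar : V ⊕ (R ⊕ A) → Bool) (hαstar : ∀ c ∈ H', ClauseSat αstar c)
    (hmax : ∀ β : V ⊕ (R ⊕ A) → Bool, (∀ c ∈ H', ClauseSat β c) →
      ((∑ r : R, if β (Sum.inr (Sum.inl r)) = true then price (typeOf r) else 0) +
       (∑ a : A, if β (Sum.inr (Sum.inr a)) = true then priceA else 0)) ≤
      ((∑ r : R, if αstar (Sum.inr (Sum.inl r)) = true then price (typeOf r) else 0) +
       (∑ a : A, if αstar (Sum.inr (Sum.inr a)) = true then priceA else 0))) :
    (IsOutcome (σs αstar) (πs αstar) ∧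
      ∀ i, ∃ a : A, Achieves typeOf (πs αstar) a (gR i) (gP i) (gD i)) ∧
    ∀ (σ' : MRAStrategy A R) (π' : ℕ → R → Option A),
      IsOutcome σ' π' →
      (∀ i, ∃ a : A, Achieves typeOf π' a (gR i) (gP i) (gD i)) →
      cMRA typeOf price priceA (Finset.univ.sup gD) (πs αstar) ≤
        cMRA typeOf price priceA (Finset.univ.sup gD) π' := by
  classical
  have weight_add_cost : ∀ α : V ⊕ (R ⊕ A) → Bool, (∀ c ∈ H', ClauseSat α c) →
      ((∑ r : R, if α (Sum.inr (Sum.inl r)) = true then price (typeOf r) else 0) +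
       (∑ a : A, if α (Sum.inr (Sum.inr a)) = true then priceA else 0)) +
        cMRA typeOf price priceA (Finset.univ.sup gD) (πs α) =
      (∑ r : R, price (typeOf r)) + ∑ _a : A, priceA := by
    intro α hα
    rw [cMRA, cRes, cAgt, add_add_add_comm]
    convert congrArg₂ (· + ·)
      (sum_ite_add_sum_ite_compl _ _ (hnuR α hα) fun r => price (typeOf r))
      (sum_ite_add_sum_ite_compl _ _ (hnuA α hα) fun _ => priceA)
  refine ⟨hchar αstar hαstar, fun σ' π' hout hwin => ?_⟩
  obtain ⟨β, hβ, -, rfl⟩ := hsurj σ' π' hout hwin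
  have hle := hmax β hβ
  have hstar := weight_add_cost αstar hαstar
  have hbeta := weight_add_cost β hβ
  omega
end
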